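/- Let f be a length-preserving involution on permutations that is shuffle-compatibility-preserving and rotation-preserving, and let cst₁ and cst₂ be f-equivalent cyclic permutation statistics. If cst₁ is cyclic shuffle-compatible, then cst₂ is cyclic shuffle-compatible. -/

import Mathlib

/-- A permutation: a list of distinct positive integers. -/
def IsPerm (π : List ℕ) : Prop := π.Nodup ∧ ∀ x ∈ π, 0 < x

/-- The descent set `Des π = {i ∈ {1,…,n−1} : π_i > π_{i+1}}` (1-based indexing). -/
def Des (π : List ℕ) : Finset ℕ :=
  (Finset.Icc 1 (π.length - 1)).filter fun i => π.getD i 0 < π.getD (i - 1) 0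

/-- The descent number. -/
def des (π : List ℕ) : ℕ := (Des π).card

/-- The major index. -/
def maj (π : List ℕ) : ℕ := ∑ i ∈ Des π, i

/-- The cyclic descent set `cDes π = {i ∈ {1,…,n} : π_i > π_{i+1}}`, indices mod `n`. -/
def cDes (π : List ℕ) : Finset ℕ :=
  (Finset.Icc 1 π.length).filter fun i => π.getD (i % π.length) 0 < π.getD (i - 1) 0

/-- The cyclic descent number. -/
def cdes (π : List ℕ) : ℕ := (cDes π).card

/-- The cyclic major index. -/
def cmaj (π : List ℕ) : ℕ := ∑ i ∈ cDes π, i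

/-- The peak set `Pk π = {i ∈ {2,…,n−1} : π_{i−1} < π_i > π_{i+1}}` (1-based indexing). -/
def Pk (π : List ℕ) : Finset ℕ :=
  (Finset.Icc 2 (π.length - 1)).filter fun i =>
    π.getD (i - 2) 0 < π.getD (i - 1) 0 ∧ π.getD i 0 < π.getD (i - 1) 0

/-- The peak number. -/
def pk (π : List ℕ) : ℕ := (Pk π).card

/-- The cyclic peak set `cPk π = {i ∈ {1,…,n} : π_{i−1} < π_i > π_{i+1}}`, indices mod `n`. -/
def cPk (π : List ℕ) : Finset ℕ :=
  (Finset.Icc 1 π.length).filter fun i =>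
    π.getD ((i + π.length - 2) % π.length) 0 < π.getD (i - 1) 0 ∧
      π.getD (i % π.length) 0 < π.getD (i - 1) 0

/-- The cyclic peak number. -/
def cpk (π : List ℕ) : ℕ := (cPk π).card

/-- The cyclic valley set `cVal π = {i ∈ {1,…,n} : π_{i−1} > π_i < π_{i+1}}`, indices mod `n`. -/
def cVal (π : List ℕ) : Finset ℕ :=
  (Finset.Icc 1 π.length).filter fun i =>
    π.getD (i - 1) 0 < π.getD ((i + π.length - 2) % π.length) 0 ∧
      π.getD (i - 1) 0 < π.getD (i % π.length) 0

/-- The cyclic valley number. -/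
def cval (π : List ℕ) : ℕ := (cVal π).card

/-- The distribution of a linear statistic `st` over the `n` rotations of `π`,
i.e. the multiset-valued cyclic statistic induced by `st`, evaluated at `[π]`. -/
def cycStat {A : Type*} (st : List ℕ → A) (π : List ℕ) : Multiset A :=
  (Multiset.range π.length).map fun i => st (π.rotate i)

/-- `τ` is a (linear) shuffle of `π` and `σ`. -/
def IsShuffle (π σ τ : List ℕ) : Prop :=
  π.Sublist τ ∧ σ.Sublist τ ∧ τ.length = π.length + σ.length

/-- `[τ]` is a cyclic shuffle of `[π]` and `[σ]`: some rotation of `τ` is a shuffle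
of some rotation of `π` and some rotation of `σ`. -/
def IsCyclicShuffle (π σ τ : List ℕ) : Prop :=
  ∃ i j k, IsShuffle (π.rotate i) (σ.rotate j) (τ.rotate k)

/-- The set of cyclic shuffles of `[π]` and `[σ]` (as elements of `Cycle ℕ`, so that each
cyclic shuffle is counted once) on which the statistic `cst` takes the value `v`. -/
def cycShuffleFiber {A : Type*} (cst : List ℕ → A) (π σ : List ℕ) (v : A) : Set (Cycle ℕ) :=
  {c : Cycle ℕ | ∃ τ : List ℕ, (↑τ : Cycle ℕ) = c ∧ IsCyclicShuffle π σ τ ∧ cst τ = v}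

/-- A (rotation-invariant) statistic `cst` is cyclic shuffle-compatible if the distribution
of `cst` over the set of cyclic shuffles of `[π]` and `[σ]` (each cyclic shuffle counted
once) depends only on `cst π`, `cst σ`, `|π|` and `|σ|`. -/
def CyclicShuffleCompatible {A : Type*} (cst : List ℕ → A) : Prop :=
  ∀ π σ π' σ' : List ℕ, IsPerm π → IsPerm σ → IsPerm π' → IsPerm σ' →
    π.Disjoint σ → π'.Disjoint σ' →
    π.length = π'.length → σ.length = σ'.length →
    cst π = cst π' → cst σ = cst σ' →
    ∀ v : A, (cycShuffleFiber cst π σ v).ncard = (cycShuffleFiber cst π' σ' v).ncard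

/-- Two permutations have the same relative order (the same standardization). -/
def SameRelOrder (π σ : List ℕ) : Prop :=
  π.length = σ.length ∧ ∀ i j, i < π.length → j < π.length →
    (π.getD i 0 < π.getD j 0 ↔ σ.getD i 0 < σ.getD j 0)

/-- A linear permutation statistic: invariant under relative order. -/
def IsStatistic {A : Type*} (st : List ℕ → A) : Prop :=
  ∀ π σ, IsPerm π → IsPerm σ → SameRelOrder π σ → st π = st σ

/-- `f` is rotation-preserving: `[π]^f = [π^f]` for every permutation `π`. -/
def RotPreserving (f : List ℕ → List ℕ) : Prop :=
  ∀ π, IsPerm π → f '' {l | π.IsRotated l} = {l | (f π).IsRotated l}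

/-- `f` is shuffle-compatibility-preserving. -/
def ShuffleCompatPreserving (f : List ℕ → List ℕ) : Prop :=
  ∀ π σ, IsPerm π → IsPerm σ → π.Disjoint σ →
    ∃ πh σh, IsPerm πh ∧ IsPerm σh ∧ πh.Disjoint σh ∧
      SameRelOrder π πh ∧ SameRelOrder σ σh ∧
      f '' {τ | IsShuffle π σ τ} = {τ | IsShuffle (f πh) (f σh) τ} ∧
      f '' {τ | IsShuffle πh σh τ} = {τ | IsShuffle (f π) (f σ) τ}

/-- A cyclic permutation statistic: rotation-invariant (so that it is well defined on
cyclic permutations) and invariant under relative order. -/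
def IsCyclicStatistic {A : Type*} (cst : List ℕ → A) : Prop :=
  (∀ π i, cst (π.rotate i) = cst π) ∧
    ∀ π σ, IsPerm π → IsPerm σ → SameRelOrder π σ → cst π = cst σ

namespace List

/-- Two distinct lists that agree after erasing `a` and after erasing `b` differ by swapping
`a` and `b` in adjacent positions. -/
theorem adjacent_swap_of_erase_eq {a b : ℕ} (hab : a ≠ b) : ∀ {v v' : List ℕ}, v ≠ v' →
    a ∈ v → a ∈ v' → v.erase a = v'.erase a → v.erase b = v'.erase b →
    ∃ p q, (v = p ++ a :: b :: q ∧ v' = p ++ b :: a :: q) ∨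
      (v = p ++ b :: a :: q ∧ v' = p ++ a :: b :: q)
  | [], _, _, h, _, _, _ => by simp at h
  | _ :: _, [], _, _, h, _, _ => by simp at h
  | c :: t, c' :: t', hne, ha, ha', hea, heb => by
    by_cases hc : c = c'
    · subst hc
      have ht : t ≠ t' := fun h => hne (by rw [h])
      have hca : c ≠ a := by rintro rfl; simp at hea; exact ht hea
      have hcb : c ≠ b := by rintro rfl; simp at heb; exact ht heb
      rw [erase_cons_tail (by simpa using hca), erase_cons_tail (by simpa using hca)] at hea
      rw [erase_cons_tail (by simpa using hcb), erase_cons_tail (by simpa using hcb)] at heb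
      have ha1 : a ∈ t := by simpa [Ne.symm hca] using ha
      have ha2 : a ∈ t' := by simpa [Ne.symm hca] using ha'
      obtain ⟨p, q, h⟩ := adjacent_swap_of_erase_eq hab ht ha1 ha2
        (by simpa using hea) (by simpa using heb)
      refine ⟨c :: p, q, ?_⟩
      rcases h with ⟨h, h'⟩ | ⟨h, h'⟩
      · exact Or.inl ⟨by simp [h], by simp [h']⟩
      · exact Or.inr ⟨by simp [h], by simp [h']⟩
    · have hA : c = a ∨ c' = a := by grind
      have hB : c = b ∨ c' = b := by grind
      rcases hA with rfl | rfl <;> rcases hB with rfl | rfl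
      · exact absurd rfl hab
      · refine ⟨[], t.erase c', Or.inl ?_⟩
        grind
      · refine ⟨[], t'.erase c, Or.inr ?_⟩
        grind
      · exact absurd rfl hab

theorem not_swapped_of_nodup {a b : ℕ} {p q p' q' : List ℕ} (hn : (p ++ a :: b :: q).Nodup) :
    p ++ a :: b :: q ≠ p' ++ b :: a :: q' := by
  intro h
  have hn' := hn
  rw [h] at hn'
  have h' : p ++ a :: b :: q = (p' ++ [b]) ++ a :: q' := by simp [h]
  rw [append_cons_inj_of_notMem (by grind) (by grind)] at h'
  grind

theorem swap_eq_of_erase_eq {a b : ℕ} {p q v' : List ℕ} (hn : (p ++ a :: b :: q).Nodup)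
    (hne : p ++ a :: b :: q ≠ v') (ha' : a ∈ v')
    (hea : (p ++ a :: b :: q).erase a = v'.erase a)
    (heb : (p ++ a :: b :: q).erase b = v'.erase b) : v' = p ++ b :: a :: q := by
  have hab : a ≠ b := by grind
  obtain ⟨p', q', ⟨h, h'⟩ | ⟨h, -⟩⟩ :=
    adjacent_swap_of_erase_eq hab hne (by simp) ha' hea heb
  · have hn' := hn
    rw [h] at hn'
    rw [append_cons_inj_of_notMem (by grind) (by grind)] at h
    grind
  · exact absurd h (not_swapped_of_nodup hn)

/-- In a list with at least three entries, the letter erased is determined by its insertions. -/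
theorem eq_of_erase_eq_of_erase_eq {a b : ℕ} {v : List ℕ} (hn : v.Nodup) (hl : 3 ≤ v.length)
    (ha : a ∈ v) (hb : b ∈ v) (h₁ : (a :: v.erase a).erase b = v.erase b)
    (h₂ : (v.erase a ++ [a]).erase b = v.erase b) : a = b := by
  by_contra hab
  have hb' : b ∈ v.erase a := by grind
  have hl' : ((v.erase a).erase b).length = v.length - 1 - 1 := by
    rw [length_erase_of_mem hb', length_erase_of_mem ha]
  have ha' : a ∉ (v.erase a).erase b := fun h =>
    (hn.mem_erase_iff.1 (mem_of_mem_erase h)).1 rfl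
  rw [← h₁, erase_append_left _ hb', erase_cons_tail (by simpa using hab)] at h₂
  cases hc : (v.erase a).erase b with
  | nil => simp [hc] at hl'; omega
  | cons c t =>
    rw [hc] at h₂ ha'
    simp only [cons_append, cons.injEq] at h₂
    simp [h₂.1] at ha'

/-- If all consecutive entries of `u` are adjacent in `v`, then `u` or its reverse is a
contiguous block of `v`. -/
theorem isInfix_or_reverse_isInfix : ∀ {u v : List ℕ}, u.Nodup → v.Nodup → u ⊆ v →
    (∀ p a b q, u = p ++ a :: b :: q →
      ∃ p' q', v = p' ++ a :: b :: q' ∨ v = p' ++ b :: a :: q') →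
    u <:+: v ∨ u.reverse <:+: v
  | [], _, _, _, _, _ => Or.inl (nil_infix)
  | [a], v, _, _, h, _ => by
    obtain ⟨s, t, rfl⟩ := append_of_mem (h (mem_singleton_self a))
    exact Or.inl ⟨s, t, by simp⟩
  | [a, b], v, _, _, _, hadj => by
    obtain ⟨p, q, rfl | rfl⟩ := hadj [] a b [] rfl
    · exact Or.inl ⟨p, q, by simp⟩
    · exact Or.inr ⟨p, q, by simp⟩
  | a :: b :: c :: t, v, hu, hv, hsub, hadj => by
    have ih := isInfix_or_reverse_isInfix (u := b :: c :: t) (v := v) hu.of_cons hv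
      (fun x hx => hsub (mem_cons_of_mem _ hx))
      (fun p x y q h => hadj (a :: p) x y q (by rw [h]; rfl))
    have hac : a ≠ c := by grind
    obtain ⟨p, q, hpq⟩ := hadj [] a b (c :: t) rfl
    rcases ih with ⟨l, r, h⟩ | ⟨l, r, h⟩
    · left
      rcases hpq with hpq | hpq
      · have h2 : l ++ b :: (c :: t ++ r) = (p ++ [a]) ++ b :: q := by
          simpa using h.trans hpq
        rw [← h] at hv
        rw [hpq] at h
        have := (append_cons_inj_of_notMem (by grind) (by grind)).1 h2
        refine ⟨p, r, ?_⟩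
        rw [hpq, ← this.2.2]
        simp
      · exfalso
        have h2 : l ++ b :: (c :: t ++ r) = p ++ b :: (a :: q) := by
          simpa using h.trans hpq
        rw [← h] at hv
        have := (append_cons_inj_of_notMem (by grind) (by grind)).1 h2
        grind
    · right
      rcases hpq with hpq | hpq
      · exfalso
        have h2 : (l ++ t.reverse ++ [c]) ++ b :: r = (p ++ [a]) ++ b :: q := by
          simpa using h.trans hpq
        rw [← h] at hv
        have := (append_cons_inj_of_notMem (by grind) (by grind)).1 h2
        have := append_inj_right' this.1 rfl
        grind
      · have h2 : (l ++ t.reverse ++ [c]) ++ b :: r = p ++ b :: (a :: q) := by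
          simpa using h.trans hpq
        rw [← h] at hv
        have := (append_cons_inj_of_notMem (by grind) (by grind)).1 h2
        refine ⟨l, q, ?_⟩
        rw [hpq, ← this.1]
        simp

theorem exists_perm_map_eq : ∀ {u v : List ℕ}, u.Nodup → v.Nodup → u.length = v.length →
    ∃ h : Equiv.Perm ℕ, u.map h = v
  | [], [], _, _, _ => ⟨1, rfl⟩
  | x :: u, y :: v, hu, hv, hl => by
    obtain ⟨h, rfl⟩ := exists_perm_map_eq hu.of_cons hv.of_cons (by simpa using hl)
    refine ⟨h.trans (Equiv.swap (h x) y), ?_⟩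
    simp only [map_cons, Equiv.trans_apply, Equiv.swap_apply_left, cons.injEq, true_and]
    refine map_congr_left fun z hz => ?_
    refine Equiv.swap_apply_of_ne_of_ne ?_ ?_
    · rintro h'
      rw [h.injective h'] at hz
      exact (nodup_cons.1 hu).1 hz
    · rintro rfl
      exact (nodup_cons.1 hv).1 (mem_map_of_mem hz)

/-- A property preserved by adjacent swaps is invariant under permutation. -/
theorem Perm.induction_adjacent_swap {P : List ℕ → Prop}
    (hP : ∀ p x y q, P (p ++ x :: y :: q) → P (p ++ y :: x :: q)) {u v : List ℕ} (h : u ~ v) :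
    P u → P v := by
  suffices H : ∀ p, P (p ++ u) → P (p ++ v) from H []
  induction h with
  | nil => exact fun _ => id
  | cons x _ ih => intro p hp; simpa using ih (p ++ [x]) (by simpa using hp)
  | swap x y l => exact fun p => hP p y x l
  | trans _ _ ih₁ ih₂ => exact fun p => ih₂ p ∘ ih₁ p

end List

theorem IsPerm.of_perm {π σ : List ℕ} (h : IsPerm π) (hp : π.Perm σ) : IsPerm σ :=
  ⟨hp.nodup_iff.1 h.1, fun x hx => h.2 x (hp.mem_iff.2 hx)⟩

theorem IsPerm.append {π σ : List ℕ} (hπ : IsPerm π) (hσ : IsPerm σ) (hd : π.Disjoint σ) :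
    IsPerm (π ++ σ) :=
  ⟨hπ.1.append hσ.1 hd, fun x hx => (List.mem_append.1 hx).elim (hπ.2 x) (hσ.2 x)⟩

theorem IsShuffle.perm {π σ τ : List ℕ} (h : IsShuffle π σ τ) (hn : (π ++ σ).Nodup) :
    τ.Perm (π ++ σ) := by
  have hs : (π ++ σ).Subperm τ := hn.subperm fun x hx =>
    (List.mem_append.1 hx).elim (fun hx => h.1.subset hx) fun hx => h.2.1.subset hx
  exact (hs.perm_of_length_le (by simp [h.2.2])).symm

theorem isShuffle_append (π σ : List ℕ) : IsShuffle π σ (π ++ σ) :=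
  ⟨List.sublist_append_left _ _, List.sublist_append_right _ _, by simp⟩

theorem IsShuffle.symm {π σ τ : List ℕ} (h : IsShuffle π σ τ) : IsShuffle σ π τ :=
  ⟨h.2.1, h.1, by rw [h.2.2, add_comm]⟩

theorem isShuffle_singleton_iff {a : ℕ} {τ v : List ℕ} (hn : (a :: τ).Nodup) :
    IsShuffle [a] τ v ↔ a ∈ v ∧ v.erase a = τ := by
  constructor
  · rintro ⟨h₁, h₂, h₃⟩
    have ha : a ∈ v := List.singleton_sublist.1 h₁
    refine ⟨ha, ?_⟩
    have h := h₂.erase a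
    rw [List.erase_of_not_mem (List.nodup_cons.1 hn).1] at h
    refine (h.eq_of_length ?_).symm
    rw [List.length_erase_of_mem ha, h₃]
    simp
  · rintro ⟨ha, rfl⟩
    refine ⟨List.singleton_sublist.2 ha, List.erase_sublist, ?_⟩
    have := List.length_pos_of_mem ha
    rw [List.length_erase_of_mem ha, List.length_singleton]
    omega

theorem IsCyclicShuffle.symm {π σ τ : List ℕ} (h : IsCyclicShuffle π σ τ) :
    IsCyclicShuffle σ π τ := by
  obtain ⟨i, j, k, h⟩ := h
  exact ⟨j, i, k, h.symm⟩

theorem IsCyclicShuffle.perm {π σ τ : List ℕ} (h : IsCyclicShuffle π σ τ)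
    (hn : (π ++ σ).Nodup) : τ.Perm (π ++ σ) := by
  obtain ⟨i, j, k, h⟩ := h
  have hp := (List.rotate_perm π i).append (List.rotate_perm σ j)
  exact (List.rotate_perm τ k).symm.trans ((h.perm (hp.nodup_iff.2 hn)).trans hp)

theorem isCyclicShuffle_iff {π σ τ : List ℕ} : IsCyclicShuffle π σ τ ↔
    ∃ π' σ' τ', π ~r π' ∧ σ ~r σ' ∧ τ ~r τ' ∧ IsShuffle π' σ' τ' :=
  ⟨fun ⟨i, j, k, h⟩ => ⟨_, _, _, ⟨i, rfl⟩, ⟨j, rfl⟩, ⟨k, rfl⟩, h⟩,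
    fun ⟨_, _, _, ⟨i, hi⟩, ⟨j, hj⟩, ⟨k, hk⟩, h⟩ => ⟨i, j, k, by rwa [hi, hj, hk]⟩⟩

theorem IsCyclicShuffle.map {π σ τ : List ℕ} (h : IsCyclicShuffle π σ τ) (g : ℕ → ℕ) :
    IsCyclicShuffle (π.map g) (σ.map g) (τ.map g) := by
  obtain ⟨π', σ', τ', h₁, h₂, h₃, h⟩ := isCyclicShuffle_iff.1 h
  exact isCyclicShuffle_iff.2 ⟨_, _, _, h₁.map g, h₂.map g, h₃.map g,
    h.1.map g, h.2.1.map g, by simp [h.2.2]⟩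

theorem IsShuffle.reverse {π σ τ : List ℕ} (h : IsShuffle π σ τ) :
    IsShuffle π.reverse σ.reverse τ.reverse :=
  ⟨h.1.reverse, h.2.1.reverse, by simp [h.2.2]⟩

theorem IsCyclicShuffle.reverse {π σ τ : List ℕ} (h : IsCyclicShuffle π σ τ) :
    IsCyclicShuffle π.reverse σ.reverse τ.reverse := by
  obtain ⟨π', σ', τ', h₁, h₂, h₃, h⟩ := isCyclicShuffle_iff.1 h
  exact isCyclicShuffle_iff.2 ⟨_, _, _, h₁.reverse, h₂.reverse, h₃.reverse, h.reverse⟩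

/-- The set of shuffles determines the pair of lists being shuffled, up to order. -/
theorem eq_or_swap_of_isShuffle_iff {A B X Y : List ℕ} (hAB : (A ++ B).Nodup)
    (hXY : X.Disjoint Y) (hA : A.length = X.length) (hB : B.length = Y.length)
    (h₁ : IsShuffle X Y (A ++ B)) (h₂ : IsShuffle X Y (B ++ A)) :
    (A = X ∧ B = Y) ∨ (A = Y ∧ B = X) := by
  have key : ∀ Z : List ℕ, Z.Sublist (A ++ B) → Z.Sublist (B ++ A) →
      Z.Sublist A ∨ Z.Sublist B := by
    intro Z hZ₁ hZ₂
    have hd := List.disjoint_of_nodup_append hAB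
    obtain ⟨Z₁, Z₂, hZ, hs₁, hs₂⟩ := List.sublist_append_iff.1 hZ₁
    obtain ⟨Z₃, Z₄, hZ', hs₃, hs₄⟩ := List.sublist_append_iff.1 hZ₂
    cases Z₁ with
    | nil => right; simpa [hZ] using hs₂
    | cons z Z₁ =>
      cases Z₃ with
      | nil => left; simpa [hZ'] using hs₄
      | cons z' Z₃ =>
        rw [hZ] at hZ'
        simp only [List.cons_append, List.cons.injEq] at hZ'
        exact absurd (hZ'.1 ▸ hs₃.subset List.mem_cons_self)
          (hd (hs₁.subset List.mem_cons_self))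
  have eq_nil : ∀ {U V : List ℕ}, U ⊆ V → U.Disjoint V → U = [] := fun hs hd =>
    List.eq_nil_iff_forall_not_mem.2 fun x hx => hd hx (hs hx)
  rcases key X h₁.1 h₂.1 with hX | hX <;> rcases key Y h₁.2.1 h₂.2.1 with hY | hY
  · have hAX := hX.eq_of_length hA.symm
    have hY0 := eq_nil (hAX ▸ hY.subset) hXY.symm
    subst hY0
    exact Or.inl ⟨hAX.symm, List.length_eq_zero_iff.1 hB⟩
  · exact Or.inl ⟨(hX.eq_of_length hA.symm).symm, (hY.eq_of_length hB.symm).symm⟩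
  · have := hX.length_le
    have := hY.length_le
    exact Or.inr ⟨(hY.eq_of_length (by omega)).symm, (hX.eq_of_length (by omega)).symm⟩
  · have hBY := hY.eq_of_length hB.symm
    have hX0 := eq_nil (hBY ▸ hX.subset) hXY
    subst hX0
    exact Or.inl ⟨List.length_eq_zero_iff.1 hA, hBY.symm⟩

/-- `f` carries the set of words obtained from `w` by moving `x` to the set of words obtained
from `f w` by moving `a`. -/
def MovesTo (f : List ℕ → List ℕ) (w : List ℕ) (x a : ℕ) : Prop :=
  x ∈ w ∧ a ∈ f w ∧ ∀ v, IsPerm v →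
    (x ∈ v ∧ v.erase x = w.erase x ↔ a ∈ f v ∧ (f v).erase a = (f w).erase a)

/-- A length-preserving and shuffle-compatibility-preserving involution on permutations. -/
structure IsShuffleInvolution (f : List ℕ → List ℕ) : Prop where
  isPerm : ∀ π, IsPerm π → IsPerm (f π)
  invol : ∀ π, IsPerm π → f (f π) = π
  len : ∀ π, IsPerm π → (f π).length = π.length
  scp : ShuffleCompatPreserving f

namespace IsShuffleInvolution

variable {f : List ℕ → List ℕ}

theorem inj (hf : IsShuffleInvolution f) {v w : List ℕ} (hv : IsPerm v) (hw : IsPerm w)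
    (h : f v = f w) : v = w := by
  rw [← hf.invol v hv, h, hf.invol w hw]

theorem isShuffle_iff_of_image_eq (hf : IsShuffleInvolution f) {π σ π' σ' : List ℕ}
    (hn : IsPerm (π ++ σ)) (h : f '' {τ | IsShuffle π σ τ} = {τ | IsShuffle π' σ' τ})
    {τ : List ℕ} (hτ : IsPerm τ) : IsShuffle π σ τ ↔ IsShuffle π' σ' (f τ) := by
  constructor
  · exact fun hs => h.subset ⟨τ, hs, rfl⟩
  · intro hs
    obtain ⟨τ', hs', he⟩ := h.symm.subset hs
    exact hf.inj (hn.of_perm (IsShuffle.perm hs' hn.1).symm) hτ he ▸ hs'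

theorem isPerm_of_image_eq (hf : IsShuffleInvolution f) {π σ π' σ' : List ℕ}
    (hn : IsPerm (π ++ σ)) (h : f '' {τ | IsShuffle π σ τ} = {τ | IsShuffle π' σ' τ})
    {τ : List ℕ} (hs : IsShuffle π' σ' τ) : IsPerm τ := by
  obtain ⟨τ', hs', rfl⟩ := h.symm.subset hs
  exact hf.isPerm _ (hn.of_perm (IsShuffle.perm hs' hn.1).symm)

theorem exists_movesTo (hf : IsShuffleInvolution f) {w : List ℕ} (hw : IsPerm w) {x : ℕ}
    (hx : x ∈ w) : ∃ a, MovesTo f w x a := by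
  have hp := List.perm_cons_erase hx
  have hxw : IsPerm ([x] ++ w.erase x) := hw.of_perm hp
  have hxw' : (x :: w.erase x).Nodup := hxw.1
  have h1 : IsPerm [x] := ⟨by simp, by simpa using hw.2 x hx⟩
  have h2 : IsPerm (w.erase x) := ⟨hw.1.erase x, fun y hy => hw.2 y (List.mem_of_mem_erase hy)⟩
  obtain ⟨πh, σh, hπ, -, -, hsπ, -, him, -⟩ :=
    hf.scp [x] (w.erase x) h1 h2 (List.disjoint_of_nodup_append hxw.1)
  obtain ⟨a, ha⟩ : ∃ a, f πh = [a] := List.length_eq_one_iff.1 (by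
    rw [hf.len πh hπ, ← hsπ.1, List.length_singleton])
  rw [ha] at him
  have hn : (a :: f σh).Nodup := (hf.isPerm_of_image_eq hxw him (isShuffle_append _ _)).1
  have key : ∀ v, IsPerm v → (x ∈ v ∧ v.erase x = w.erase x ↔ a ∈ f v ∧ (f v).erase a = f σh) := by
    intro v hv
    rw [← isShuffle_singleton_iff hxw', ← isShuffle_singleton_iff hn]
    exact hf.isShuffle_iff_of_image_eq hxw him hv
  obtain ⟨haw, hew⟩ := (key w hw).1 ⟨hx, rfl⟩
  exact ⟨a, hx, haw, by rwa [hew]⟩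

theorem movesTo_unique_right (hf : IsShuffleInvolution f) {w : List ℕ} (hw : IsPerm w)
    (hl : 3 ≤ w.length) {x a b : ℕ} (ha : MovesTo f w x a) (hb : MovesTo f w x b) : a = b := by
  have hfw := hf.isPerm w hw
  have key : ∀ u : List ℕ, u.Perm (f w) → u.erase a = (f w).erase a → u.erase b = (f w).erase b := by
    intro u hu he
    have hup := hfw.of_perm hu.symm
    have h := (ha.2.2 (f u) (hf.isPerm u hup)).symm.trans (hb.2.2 (f u) (hf.isPerm u hup))
    rw [hf.invol u hup] at h
    exact (h.1 ⟨hu.mem_iff.2 ha.2.1, he⟩).2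
  have hp := List.perm_cons_erase ha.2.1
  have hp' : ((f w).erase a ++ [a]).Perm (f w) := (List.perm_append_singleton _ _).trans hp.symm
  have hna : a ∉ (f w).erase a := hfw.1.not_mem_erase
  refine List.eq_of_erase_eq_of_erase_eq hfw.1 (by rwa [hf.len w hw]) ha.2.1 hb.2.1
    (key _ hp.symm (by simp)) (key _ hp' ?_)
  rw [List.erase_append_right _ hna]
  simp

theorem movesTo_unique_left {w : List ℕ} (hw : IsPerm w)
    (hl : 3 ≤ w.length) {x y a : ℕ} (hx : MovesTo f w x a) (hy : MovesTo f w y a) : x = y := by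
  have key : ∀ u : List ℕ, u.Perm w → u.erase x = w.erase x → u.erase y = w.erase y := by
    intro u hu he
    have hup := hw.of_perm hu.symm
    exact (((hx.2.2 u hup).trans (hy.2.2 u hup).symm).1 ⟨hu.mem_iff.2 hx.1, he⟩).2
  have hp := List.perm_cons_erase hx.1
  have hp' : (w.erase x ++ [x]).Perm w := (List.perm_append_singleton _ _).trans hp.symm
  have hna : x ∉ w.erase x := hw.1.not_mem_erase
  refine List.eq_of_erase_eq_of_erase_eq hw.1 hl hx.1 hy.1
    (key _ hp.symm (by simp)) (key _ hp' ?_)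
  rw [List.erase_append_right _ hna]
  simp

theorem movesTo_congr {w w' : List ℕ} (hw' : IsPerm w') {x a : ℕ} (h : MovesTo f w x a)
    (hx : x ∈ w') (he : w'.erase x = w.erase x) : MovesTo f w' x a := by
  obtain ⟨ha, he'⟩ := (h.2.2 w' hw').1 ⟨hx, he⟩
  exact ⟨hx, ha, by rw [he, he']; exact h.2.2⟩

theorem erase_swap_left {x y : ℕ} {p q : List ℕ} (hn : (p ++ x :: y :: q).Nodup) :
    (p ++ y :: x :: q).erase x = (p ++ x :: y :: q).erase x := by
  rw [List.erase_append_right _ (by grind), List.erase_append_right _ (by grind)]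
  grind

theorem erase_swap_right {x y : ℕ} {p q : List ℕ} (hn : (p ++ x :: y :: q).Nodup) :
    (p ++ y :: x :: q).erase y = (p ++ x :: y :: q).erase y := by
  rw [List.erase_append_right _ (by grind), List.erase_append_right _ (by grind)]
  grind

theorem swap_perm (x y : ℕ) (p q : List ℕ) : (p ++ x :: y :: q).Perm (p ++ y :: x :: q) :=
  (List.Perm.swap y x q).append_left p

/-- On words with at least three letters, `f` relabels each word, possibly reversing it. -/
theorem exists_map_eq_or_reverse (hf : IsShuffleInvolution f) {w : List ℕ} (hw : IsPerm w)
    (hl : 3 ≤ w.length) : ∃ ψ : ℕ → ℕ, (∀ x ∈ w, MovesTo f w x (ψ x)) ∧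
      (f w = w.map ψ ∨ f w = (w.map ψ).reverse) := by
  choose! ψ hψ using fun x hx => hf.exists_movesTo hw (x := x) hx
  refine ⟨ψ, hψ, ?_⟩
  have hfw := hf.isPerm w hw
  have hinj : ∀ x ∈ w, ∀ y ∈ w, ψ x = ψ y → x = y := fun x hx y hy h =>
    movesTo_unique_left hw hl (hψ x hx) (h ▸ hψ y hy)
  have hn : (w.map ψ).Nodup := hw.1.map_on hinj
  have hlen : (w.map ψ).length = (f w).length := by rw [List.length_map, hf.len w hw]
  have h := List.isInfix_or_reverse_isInfix hn hfw.1
    (fun a ha => by obtain ⟨x, hx, rfl⟩ := List.mem_map.1 ha; exact (hψ x hx).2.1) ?_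
  · rcases h with h | h
    · exact Or.inl (h.eq_of_length hlen).symm
    · exact Or.inr (h.eq_of_length (by simpa using hlen)).symm
  · intro p a b q hpq
    obtain ⟨p, t, rfl, rfl, ht⟩ := List.map_eq_append_iff.1 hpq
    obtain ⟨x, t, rfl, rfl, ht'⟩ := List.map_eq_cons_iff.1 ht
    obtain ⟨y, q, rfl, rfl, rfl⟩ := List.map_eq_cons_iff.1 ht'
    have hxy : x ≠ y := by have := hw.1; grind
    have hx := hψ x (by simp)
    have hy := hψ y (by simp)
    have hw' := hw.of_perm (swap_perm x y p q)
    have h1 := (hx.2.2 _ hw').1 ⟨by simp, erase_swap_left hw.1⟩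
    have h2 := (hy.2.2 _ hw').1 ⟨by simp, erase_swap_right hw.1⟩
    have hne : f (p ++ x :: y :: q) ≠ f (p ++ y :: x :: q) := fun h => by
      have := hf.inj hw hw' h
      simp [hxy] at this
    obtain ⟨p', q', h | h⟩ := List.adjacent_swap_of_erase_eq
      (fun h => hxy (hinj x (by simp) y (by simp) h)) hne hx.2.1 h1.1 h1.2.symm h2.2.symm
    · exact ⟨p', q', Or.inl h.1⟩
    · exact ⟨p', q', Or.inr h.1⟩

theorem relabel_swap (hf : IsShuffleInvolution f) (h : Equiv.Perm ℕ) {r : List ℕ → List ℕ}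
    (hr : r = id ∨ r = List.reverse) {p q : List ℕ} {x y : ℕ}
    (hw : IsPerm (p ++ x :: y :: q)) (hl : 3 ≤ (p ++ x :: y :: q).length)
    (hm : ∀ z ∈ p ++ x :: y :: q, MovesTo f (p ++ x :: y :: q) z (h z))
    (he : f (p ++ x :: y :: q) = r ((p ++ x :: y :: q).map h)) :
    (∀ z ∈ p ++ y :: x :: q, MovesTo f (p ++ y :: x :: q) z (h z)) ∧
      f (p ++ y :: x :: q) = r ((p ++ y :: x :: q).map h) := by
  have hfw := hf.isPerm _ hw
  have hxy : x ≠ y := by have := hw.1; grind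
  have hw' := hw.of_perm (swap_perm x y p q)
  have hl' : 3 ≤ (p ++ y :: x :: q).length := by simpa using hl
  have hx := hm x (by simp)
  have hy := hm y (by simp)
  have h1 := (hx.2.2 _ hw').1 ⟨by simp, erase_swap_left hw.1⟩
  have h2 := (hy.2.2 _ hw').1 ⟨by simp, erase_swap_right hw.1⟩
  have hne : f (p ++ x :: y :: q) ≠ f (p ++ y :: x :: q) := fun h => by
    have := hf.inj hw hw' h
    simp [hxy] at this
  have hfw' : f (p ++ y :: x :: q) = r ((p ++ y :: x :: q).map h) := by
    rcases hr with rfl | rfl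
    · simp only [List.map_append, List.map_cons, id] at he ⊢
      rw [he] at hne h1 h2 hfw
      exact List.swap_eq_of_erase_eq hfw.1 hne h1.1 h1.2.symm h2.2.symm
    · simp only [List.map_append, List.map_cons, List.reverse_append, List.reverse_cons,
        List.append_assoc, List.singleton_append] at he ⊢
      rw [he] at hne h1 h2 hfw
      exact List.swap_eq_of_erase_eq hfw.1 hne h2.1 h2.2.symm h1.2.symm
  refine ⟨?_, hfw'⟩
  obtain ⟨ψ, hψ, hψ'⟩ := hf.exists_map_eq_or_reverse hw' hl'
  have hψx : ψ x = h x := hf.movesTo_unique_right hw' hl' (hψ x (by simp))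
    (movesTo_congr hw' hx (by simp) (erase_swap_left hw.1))
  have hψy : ψ y = h y := hf.movesTo_unique_right hw' hl' (hψ y (by simp))
    (movesTo_congr hw' hy (by simp) (erase_swap_right hw.1))
  have hn : ((p ++ y :: x :: q).map ψ).Nodup := by
    have := (hf.isPerm _ hw').1
    rcases hψ' with h' | h' <;> rw [h'] at this
    · exact this
    · exact List.nodup_reverse.1 this
  have heq : (p ++ y :: x :: q).map ψ = (p ++ y :: x :: q).map h := by
    have hsame : ∀ u : List ℕ, u = (p ++ y :: x :: q).map h →
        (p ++ y :: x :: q).map ψ ≠ u.reverse := by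
      rintro u rfl hu
      simp only [List.map_append, List.map_cons, hψx, hψy, List.reverse_append,
        List.reverse_cons, List.append_assoc, List.singleton_append] at hn hu
      exact List.not_swapped_of_nodup hn hu
    rw [hfw'] at hψ'
    rcases hr with rfl | rfl <;> rcases hψ' with h' | h'
    · exact h'.symm
    · exact absurd (by rw [← List.reverse_eq_iff.2 h']; rfl) (hsame _ rfl)
    · exact absurd h'.symm (hsame _ rfl)
    · exact (List.reverse_injective h').symm
  intro z hz
  rw [← List.map_inj_left.1 heq z hz]
  exact hψ z hz

/-- On the words with a given set of letters, `f` is a relabelling, possibly followed by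
reversal. -/
theorem exists_relabel (hf : IsShuffleInvolution f) {w : List ℕ} (hw : IsPerm w) :
    ∃ (h : Equiv.Perm ℕ) (r : List ℕ → List ℕ), (r = id ∨ r = List.reverse) ∧
      ∀ v, v.Perm w → f v = r (v.map h) := by
  by_cases hl : 3 ≤ w.length
  · obtain ⟨ψ, hψ, hfw⟩ := hf.exists_map_eq_or_reverse hw hl
    have hn : (w.map ψ).Nodup := by
      have := (hf.isPerm _ hw).1
      rcases hfw with h' | h' <;> rw [h'] at this
      · exact this
      · exact List.nodup_reverse.1 this
    obtain ⟨h, hh⟩ := List.exists_perm_map_eq hw.1 hn (by simp)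
    obtain ⟨r, hr, hfr⟩ : ∃ r : List ℕ → List ℕ, (r = id ∨ r = List.reverse) ∧
        f w = r (w.map h) := by
      rw [hh]
      rcases hfw with h' | h'
      · exact ⟨id, Or.inl rfl, h'⟩
      · exact ⟨_, Or.inr rfl, h'⟩
    refine ⟨h, r, hr, fun v hv => ?_⟩
    have := hv.symm.induction_adjacent_swap
      (P := fun v => v.Perm w ∧ (∀ z ∈ v, MovesTo f v z (h z)) ∧ f v = r (v.map h)) ?_
      ⟨.refl _, fun z hz => by rw [List.map_inj_left.1 hh z hz]; exact hψ z hz, hfr⟩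
    · exact this.2.2
    · rintro p x y q ⟨hp, hm, he⟩
      exact ⟨(swap_perm x y p q).symm.trans hp,
        hf.relabel_swap h hr (hw.of_perm hp.symm) (by rwa [hp.length_eq]) hm he⟩
  · obtain ⟨h, hh⟩ := List.exists_perm_map_eq hw.1 (hf.isPerm w hw).1 (hf.len w hw).symm
    refine ⟨h, id, Or.inl rfl, fun v hv => ?_⟩
    match w, hl with
    | [], _ => rw [hv.eq_nil]; exact hh.symm
    | [x], _ => rw [List.perm_singleton.1 hv]; exact hh.symm
    | [x, y], _ =>
      rcases List.perm_pair.1 hv with rfl | rfl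
      · exact hh.symm
      · have hv' := hw.of_perm hv.symm
        have hne : f [y, x] ≠ f [x, y] := fun h' => by
          have hyx := hf.inj hv' hw h'
          have hn := hw.1
          grind
        obtain ⟨c, -, hc, hm⟩ := hf.exists_movesTo hw (x := x) (by simp)
        obtain ⟨hc', he⟩ := (hm _ hv').1 ⟨by simp, by grind⟩
        have hp : (f [y, x]).Perm (f [x, y]) := (List.perm_cons_erase hc').trans
          ((he ▸ List.Perm.refl _ : (c :: (f [y, x]).erase c).Perm _).trans
            (List.perm_cons_erase hc).symm)
        rw [← hh] at hp hne
        simp only [List.map_cons, List.map_nil] at hp hne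
        exact (List.perm_pair.1 hp).resolve_left hne
    | _ :: _ :: _ :: _, hl => simp at hl

end IsShuffleInvolution

theorem IsCyclicShuffle.relabel {π σ τ : List ℕ} (h : IsCyclicShuffle π σ τ) (g : ℕ → ℕ)
    {r : List ℕ → List ℕ} (hr : r = id ∨ r = List.reverse) :
    IsCyclicShuffle (r (π.map g)) (r (σ.map g)) (r (τ.map g)) := by
  rcases hr with rfl | rfl
  · exact h.map g
  · exact (h.map g).reverse

theorem IsShuffle.relabel {π σ τ : List ℕ} (h : IsShuffle π σ τ) (g : ℕ → ℕ)
    {r : List ℕ → List ℕ} (hr : r = id ∨ r = List.reverse) :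
    IsShuffle (r (π.map g)) (r (σ.map g)) (r (τ.map g)) := by
  have h' : IsShuffle (π.map g) (σ.map g) (τ.map g) := ⟨h.1.map g, h.2.1.map g, by simp [h.2.2]⟩
  rcases hr with rfl | rfl
  · exact h'
  · exact h'.reverse

namespace IsShuffleInvolution

variable {f : List ℕ → List ℕ}

theorem isCyclicShuffle_relabel_iff (hf : IsShuffleInvolution f) {π σ τ : List ℕ}
    (hw : IsPerm (π ++ σ)) (h : Equiv.Perm ℕ) {r : List ℕ → List ℕ}
    (hr : r = id ∨ r = List.reverse) (he : ∀ v, v.Perm (π ++ σ) → f v = r (v.map h))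
    (hτ : IsPerm τ) :
    IsCyclicShuffle π σ τ ↔ IsCyclicShuffle (r (π.map h)) (r (σ.map h)) (f τ) := by
  have hinv : ∀ u : List ℕ, r ((r (u.map h)).map h.symm) = u := by
    intro u
    rcases hr with rfl | rfl <;> simp [Function.comp_def]
  have hinv' : ∀ u : List ℕ, r ((r (u.map h.symm)).map h) = u := by
    intro u
    rcases hr with rfl | rfl <;> simp [Function.comp_def]
  constructor
  · intro hs
    rw [he τ (hs.perm hw.1)]
    exact hs.relabel h hr
  · intro hs
    have hs' := hs.relabel h.symm hr
    rw [hinv, hinv] at hs'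
    have hp := hs'.perm hw.1
    have hu := he _ hp
    rw [hinv'] at hu
    rwa [hf.inj (hw.of_perm hp.symm) hτ hu] at hs'

/-- The images under `f` of the cyclic shuffles of `[π]` and `[σ]` are the cyclic shuffles of
the images of `[π']` and `[σ']` for suitable `π'` and `σ'` of the same relative orders. -/
theorem exists_isCyclicShuffle_iff (hf : IsShuffleInvolution f) {π σ : List ℕ}
    (hπ : IsPerm π) (hσ : IsPerm σ) (hd : π.Disjoint σ) :
    ∃ π' σ', IsPerm π' ∧ IsPerm σ' ∧ SameRelOrder π π' ∧ SameRelOrder σ σ' ∧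
      (f π').Disjoint (f σ') ∧
      ∀ τ, IsPerm τ → (IsCyclicShuffle π σ τ ↔ IsCyclicShuffle (f π') (f σ') (f τ)) := by
  obtain ⟨π', σ', hπ', hσ', -, hrπ, hrσ, him, -⟩ := hf.scp π σ hπ hσ hd
  have hw := hπ.append hσ hd
  obtain ⟨h, r, hr, he⟩ := hf.exists_relabel hw
  have hAB := hf.isPerm_of_image_eq hw him (isShuffle_append _ _)
  refine ⟨π', σ', hπ', hσ', hrπ, hrσ, List.disjoint_of_nodup_append hAB.1, fun τ hτ => ?_⟩
  rw [hf.isCyclicShuffle_relabel_iff hw h hr he hτ]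
  have hlen : ∀ u : List ℕ, (r (u.map h)).length = u.length := by
    rcases hr with rfl | rfl <;> simp
  have hsh : ∀ v, IsShuffle (f π') (f σ') v → IsShuffle (r (π.map h)) (r (σ.map h)) v := by
    intro v hv
    obtain ⟨τ', hτ', rfl⟩ := him.symm.subset hv
    rw [he τ' (IsShuffle.perm hτ' hw.1)]
    exact IsShuffle.relabel hτ' h hr
  have hdis : (r (π.map h)).Disjoint (r (σ.map h)) := by
    have := (List.disjoint_map h.injective hd : (π.map h).Disjoint (σ.map h))
    rcases hr with rfl | rfl
    · exact this
    · exact fun x hx hy => this (List.mem_reverse.1 hx) (List.mem_reverse.1 hy)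
  rcases eq_or_swap_of_isShuffle_iff hAB.1 hdis (by rw [hlen, hf.len _ hπ', hrπ.1])
    (by rw [hlen, hf.len _ hσ', hrσ.1]) (hsh _ (isShuffle_append _ _))
    (hsh _ (isShuffle_append _ _).symm) with ⟨h₁, h₂⟩ | ⟨h₁, h₂⟩
  · rw [h₁, h₂]
  · rw [h₁, h₂]
    exact ⟨IsCyclicShuffle.symm, IsCyclicShuffle.symm⟩

/-- A shuffle-compatibility-preserving and rotation-preserving involution matches the fibers of
`cst₂` on one set of cyclic shuffles with the fibers of `cst₁` on another. -/
theorem ncard_cycShuffleFiber_eq {A B : Type*} (hf : IsShuffleInvolution f)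
    (hf_rot : RotPreserving f) {cst₁ : List ℕ → A} {cst₂ : List ℕ → B} {π σ π' σ' : List ℕ}
    {v : B} {v' : A} (hw : IsPerm (π ++ σ)) (hw' : IsPerm (π' ++ σ'))
    (hs : ∀ τ, IsPerm τ → (IsCyclicShuffle π σ τ ↔ IsCyclicShuffle π' σ' (f τ)))
    (hv : ∀ τ, τ.Perm (π ++ σ) → (cst₂ τ = v ↔ cst₁ (f τ) = v')) :
    (cycShuffleFiber cst₂ π σ v).ncard = (cycShuffleFiber cst₁ π' σ' v').ncard := by
  have hrot : ∀ {τ τ' : List ℕ}, IsPerm τ → τ ~r τ' → f τ ~r f τ' := fun hτ hr =>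
    (hf_rot _ hτ).subset ⟨_, hr, rfl⟩
  let F : Cycle ℕ → Cycle ℕ := fun c => (f (Quotient.out c) : List ℕ)
  have hF : ∀ τ, IsPerm τ → F (τ : Cycle ℕ) = (f τ : List ℕ) := by
    intro τ hτ
    have hr : τ ~r Quotient.out (τ : Cycle ℕ) := 
      (Quotient.mk_out (s := List.IsRotated.setoid ℕ) τ).symm
    exact Cycle.coe_eq_coe.2 (hrot hτ hr).symm
  have hperm : ∀ {τ}, IsCyclicShuffle π σ τ → IsPerm τ := fun h =>
    hw.of_perm (h.perm hw.1).symm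
  have himage : F '' cycShuffleFiber cst₂ π σ v = cycShuffleFiber cst₁ π' σ' v' := by
    ext c
    constructor
    · rintro ⟨-, ⟨τ, rfl, hτ, hτv⟩, rfl⟩
      exact ⟨f τ, (hF τ (hperm hτ)).symm, (hs τ (hperm hτ)).1 hτ, (hv τ (hτ.perm hw.1)).1 hτv⟩
    · rintro ⟨τ, rfl, hτ, hτv⟩
      have hp := hw'.of_perm (hτ.perm hw'.1).symm
      have hfp := hf.isPerm τ hp
      have hτ' : IsCyclicShuffle π σ (f τ) := (hs _ hfp).2 (by rwa [hf.invol τ hp])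
      refine ⟨_, ⟨f τ, rfl, hτ', (hv _ (hτ'.perm hw.1)).2 (by rwa [hf.invol τ hp])⟩, ?_⟩
      rw [hF _ hfp, hf.invol τ hp]
  rw [← himage, Set.InjOn.ncard_image]
  rintro - ⟨τ, rfl, hτ, -⟩ - ⟨τ', rfl, hτ', -⟩ h
  have hp := hperm hτ
  have hp' := hperm hτ'
  rw [hF τ hp, hF τ' hp', Cycle.coe_eq_coe] at h
  have := hrot (hf.isPerm τ hp) h
  rwa [hf.invol τ hp, hf.invol τ' hp', ← Cycle.coe_eq_coe] at this

end IsShuffleInvolution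

/-- If `f` is a shuffle-compatibility-preserving, rotation-preserving, length-preserving
involution on permutations, `cst₁` and `cst₂` are `f`-equivalent cyclic statistics, and
`cst₁` is cyclic shuffle-compatible, then so is `cst₂`. -/
theorem cyclic_shuffle_compatible_of_f_equivalent {A B : Type*} (f : List ℕ → List ℕ)
    (hf_perm : ∀ π, IsPerm π → IsPerm (f π))
    (hf_invol : ∀ π, IsPerm π → f (f π) = π)
    (hf_len : ∀ π, IsPerm π → (f π).length = π.length)
    (hf_scp : ShuffleCompatPreserving f)
    (hf_rot : RotPreserving f)
    (cst₁ : List ℕ → A) (cst₂ : List ℕ → B)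
    (h₁ : IsCyclicStatistic cst₁) (h₂ : IsCyclicStatistic cst₂)
    (hfeq : ∀ π σ, IsPerm π → IsPerm σ → π.length = σ.length →
      (cst₁ (f π) = cst₁ (f σ) ↔ cst₂ π = cst₂ σ))
    (hc : CyclicShuffleCompatible cst₁) :
    CyclicShuffleCompatible cst₂ := by
  have hf : IsShuffleInvolution f := ⟨hf_perm, hf_invol, hf_len, hf_scp⟩
  intro π σ π' σ' hπ hσ hπ' hσ' hd hd' hlπ hlσ hcπ hcσ v
  have hw := hπ.append hσ hd
  have hw' := hπ'.append hσ' hd'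
  obtain ⟨α, β, hα, hβ, hrα, hrβ, hdα, hs⟩ := hf.exists_isCyclicShuffle_iff hπ hσ hd
  obtain ⟨α', β', hα', hβ', hrα', hrβ', hdα', hs'⟩ := hf.exists_isCyclicShuffle_iff hπ' hσ' hd'
  have hlα : α.length = α'.length := by rw [← hrα.1, ← hrα'.1, hlπ]
  have hlβ : β.length = β'.length := by rw [← hrβ.1, ← hrβ'.1, hlσ]
  have hcα : cst₁ (f α) = cst₁ (f α') := (hfeq α α' hα hα' hlα).2 (by
    rw [← h₂.2 π α hπ hα hrα, ← h₂.2 π' α' hπ' hα' hrα', hcπ])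
  have hcβ : cst₁ (f β) = cst₁ (f β') := (hfeq β β' hβ hβ' hlβ).2 (by
    rw [← h₂.2 σ β hσ hβ hrβ, ← h₂.2 σ' β' hσ' hβ' hrβ', hcσ])
  have key : ∀ τ₀, IsPerm τ₀ → τ₀.length = π.length + σ.length → cst₂ τ₀ = v →
      (cycShuffleFiber cst₂ π σ v).ncard = (cycShuffleFiber cst₂ π' σ' v).ncard := by
    rintro τ₀ hτ₀ hl rfl
    rw [hf.ncard_cycShuffleFiber_eq hf_rot (v' := cst₁ (f τ₀)) hw
        ((hf_perm α hα).append (hf_perm β hβ) hdα) hs fun τ hτ =>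
          (hfeq τ τ₀ (hw.of_perm hτ.symm) hτ₀ (by rw [hτ.length_eq, hl, List.length_append])).symm,
      hf.ncard_cycShuffleFiber_eq hf_rot (v' := cst₁ (f τ₀)) hw'
        ((hf_perm α' hα').append (hf_perm β' hβ') hdα') hs' fun τ hτ =>
          (hfeq τ τ₀ (hw'.of_perm hτ.symm) hτ₀ (by
            rw [hτ.length_eq, hl, List.length_append, hlπ, hlσ])).symm]
    exact hc _ _ _ _ (hf_perm α hα) (hf_perm β hβ) (hf_perm α' hα') (hf_perm β' hβ') hdα hdα'
      (by rw [hf_len α hα, hf_len α' hα', hlα]) (by rw [hf_len β hβ, hf_len β' hβ', hlβ])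
      hcα hcβ _
  by_cases hne : (cycShuffleFiber cst₂ π σ v).Nonempty
  · obtain ⟨-, τ, -, hτ, hτv⟩ := hne
    have hp := hτ.perm hw.1
    exact key τ (hw.of_perm hp.symm) (by rw [hp.length_eq, List.length_append]) hτv
  by_cases hne' : (cycShuffleFiber cst₂ π' σ' v).Nonempty
  · obtain ⟨-, τ, -, hτ, hτv⟩ := hne'
    have hp := hτ.perm hw'.1
    exact key τ (hw'.of_perm hp.symm)
      (by rw [hp.length_eq, List.length_append, hlπ, hlσ]) hτv
  rw [Set.not_nonempty_iff_eq_empty.1 hne, Set.not_nonempty_iff_eq_empty.1 hne']
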